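/- Eigenfunction sup bound via the heat kernel: Let n ≥ 1, let Ω ⊆ ℝ^n be a nonempty bounded open set, let λ ≥ 0, and let u ∈ H¹₀(Ω) with ∫ u² = 1 satisfy Δ|u| ≥ −λ|u| weakly on Ω, i.e. ∫ |u|·Δφ ≥ −λ·∫ |u|·φ for every nonnegative φ ∈ C_c^∞(Ω). Then |u| ≤ e^{λ}·(8π)^{−n/4} almost everywhere. In particular, every normalized first eigenfunction of Ω is bounded by e^{λ₁(Ω)}·(8π)^{−n/4} almost everywhere. -/

import Mathlib

open MeasureTheory Metric Set Filter Bornology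
open scoped ENNReal NNReal Topology

noncomputable section

abbrev Euc (n : ℕ) := EuclideanSpace ℝ (Fin n)

/-- A smooth test function compactly supported in `Ω`. -/
def IsTestFun {n : ℕ} (Ω : Set (Euc n)) (φ : Euc n → ℝ) : Prop :=
  ContDiff ℝ (⊤ : ℕ∞) φ ∧ HasCompactSupport φ ∧ tsupport φ ⊆ Ω

/-- `u` belongs to `H¹₀(Ω)` with weak gradient `Du`: it is an `L²` limit of smooth
functions compactly supported in `Ω` whose gradients converge to `Du` in `L²`. -/
def MemH10 {n : ℕ} (Ω : Set (Euc n)) (u : Euc n → ℝ) (Du : Euc n → Euc n) : Prop :=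
  MemLp u 2 volume ∧ MemLp Du 2 volume ∧
  ∃ φ : ℕ → Euc n → ℝ, (∀ k, IsTestFun Ω (φ k)) ∧
    Tendsto (fun k => ∫ x, (φ k x - u x) ^ 2) atTop (𝓝 0) ∧
    Tendsto (fun k => ∫ x, ‖gradient (φ k) x - Du x‖ ^ 2) atTop (𝓝 0)

/-- First Dirichlet eigenvalue: infimum of the Rayleigh quotient over `H¹₀(Ω)`. -/
def lam1 {n : ℕ} (Ω : Set (Euc n)) : ℝ :=
  sInf {r | ∃ u Du, MemH10 Ω u Du ∧ (∫ x, u x ^ 2) ≠ 0 ∧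
    r = (∫ x, ‖Du x‖ ^ 2) / (∫ x, u x ^ 2)}

/-- Torsional rigidity: `tor Ω = inf { ∫ (½|∇w|² − w) : w ∈ H¹₀(Ω) }`. -/
def tor {n : ℕ} (Ω : Set (Euc n)) : ℝ :=
  sInf {r | ∃ w Dw, MemH10 Ω w Dw ∧ r = ∫ x, ((1 / 2) * ‖Dw x‖ ^ 2 - w x)}

/-- Normalized first eigenfunction of `Ω`, extended by zero outside `Ω`. -/
def IsEigenfun {n : ℕ} (Ω : Set (Euc n)) (u : Euc n → ℝ) : Prop :=
  (∀ᵐ x ∂volume, 0 ≤ u x) ∧ (∀ x ∉ Ω, u x = 0) ∧ (∫ x, u x ^ 2) = 1 ∧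
  ∃ Du, MemH10 Ω u Du ∧ (∫ x, ‖Du x‖ ^ 2) = lam1 Ω

/-- The torsion function of `Ω` (the minimizer of the torsion energy),
extended by zero outside `Ω`. -/
def IsTorsionFun {n : ℕ} (Ω : Set (Euc n)) (w : Euc n → ℝ) : Prop :=
  (∀ x ∉ Ω, w x = 0) ∧
  ∃ Dw, MemH10 Ω w Dw ∧ (∫ x, ((1 / 2) * ‖Dw x‖ ^ 2 - w x)) = tor Ω

/-- The Euclidean Laplacian `Δφ = Σᵢ ∂²φ/∂xᵢ²`. -/
def lap {n : ℕ} (φ : Euc n → ℝ) (x : Euc n) : ℝ :=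
  ∑ i : Fin n, fderiv ℝ (fun y => fderiv ℝ φ y (EuclideanSpace.single i 1)) x
    (EuclideanSpace.single i 1)


section helpers

variable {n : ℕ}

lemma cs_aux {F F' : Type*} [NormedAddCommGroup F] [NormedAddCommGroup F']
    {f : Euc n → F} {g : Euc n → F'} (hf : MemLp f 2 volume) (hg : MemLp g 2 volume) :
    ∫ x, ‖f x‖ * ‖g x‖ ≤ √(∫ x, ‖f x‖ ^ 2) * √(∫ x, ‖g x‖ ^ 2) := by
  have h := integral_mul_norm_le_Lp_mul_Lq (μ := (volume : Measure (Euc n)))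
    (f := fun x => ‖f x‖) (g := fun x => ‖g x‖) Real.HolderConjugate.two_two
    (by simpa using hf.norm) (by simpa using hg.norm)
  simpa [Real.sqrt_eq_rpow] using h

lemma int_mul_norm {F F' : Type*} [NormedAddCommGroup F] [NormedAddCommGroup F']
    {f : Euc n → F} {g : Euc n → F'} (hf : MemLp f 2 volume) (hg : MemLp g 2 volume) :
    Integrable (fun x => ‖f x‖ * ‖g x‖) := by
  simpa [Pi.mul_def] using MemLp.integrable_mul hf.norm hg.norm

lemma int_w_inner {F : Type*} [NormedAddCommGroup F] [InnerProductSpace ℝ F]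
    {f g : Euc n → F} {w : Euc n → ℝ} {C : ℝ}
    (hw : AEStronglyMeasurable w volume) (hC : ∀ᵐ x, |w x| ≤ C)
    (hf : MemLp f 2 volume) (hg : MemLp g 2 volume) :
    Integrable (fun x => w x * inner ℝ (f x) (g x)) := by
  have h1 : Integrable (fun x => inner ℝ (f x) (g x)) := by
    refine (int_mul_norm hf hg).mono (hf.1.inner hg.1) (Eventually.of_forall fun x => ?_)
    have := norm_inner_le_norm (𝕜 := ℝ) (f x) (g x)
    simpa using this
  exact h1.bdd_mul hw (by simpa using hC)

lemma tendsto_conv {F : Type*} [NormedAddCommGroup F] [InnerProductSpace ℝ F]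
    {f : ℕ → Euc n → F} {f0 χ : Euc n → F} {w : ℕ → Euc n → ℝ} {w0 : Euc n → ℝ} {C : ℝ}
    (hf : ∀ k, MemLp (f k) 2 volume) (hf0 : MemLp f0 2 volume) (hχ : MemLp χ 2 volume)
    (hw : ∀ k, AEStronglyMeasurable (w k) volume)
    (hC : ∀ k x, |w k x| ≤ C)
    (hlim : ∀ᵐ x, Tendsto (fun k => w k x) atTop (𝓝 (w0 x)))
    (hL : Tendsto (fun k => ∫ x, ‖f k x - f0 x‖ ^ 2) atTop (𝓝 0)) :
    Tendsto (fun k => ∫ x, w k x * inner ℝ (f k x) (χ x)) atTop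
      (𝓝 (∫ x, w0 x * inner ℝ (f0 x) (χ x))) := by
  have h1 : Tendsto (fun k => ∫ x, w k x * inner ℝ (f0 x) (χ x)) atTop
      (𝓝 (∫ x, w0 x * inner ℝ (f0 x) (χ x))) := by
    refine tendsto_integral_of_dominated_convergence
      (fun x => C * (‖f0 x‖ * ‖χ x‖)) (fun k => (hw k).mul (hf0.1.inner hχ.1))
      ((int_mul_norm hf0 hχ).const_mul C) ?_ ?_
    · intro k
      refine Eventually.of_forall fun x => ?_
      rw [norm_mul]
      exact mul_le_mul (hC k x) (norm_inner_le_norm _ _) (norm_nonneg _)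
        ((abs_nonneg _).trans (hC k x))
    · filter_upwards [hlim] with x hx
      exact hx.mul_const _
  have h2 : Tendsto (fun k => ∫ x, w k x * inner ℝ (f k x - f0 x) (χ x)) atTop (𝓝 0) := by
    have hb : ∀ k, ‖∫ x, w k x * inner ℝ (f k x - f0 x) (χ x)‖ ≤
        C * (√(∫ x, ‖f k x - f0 x‖ ^ 2) * √(∫ x, ‖χ x‖ ^ 2)) := by
      intro k
      have hd : MemLp (fun x => f k x - f0 x) 2 volume := (hf k).sub hf0
      have hC0 : 0 ≤ C := (abs_nonneg _).trans (hC k 0)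
      calc ‖∫ x, w k x * inner ℝ (f k x - f0 x) (χ x)‖
          ≤ ∫ x, C * (‖f k x - f0 x‖ * ‖χ x‖) := by
            refine norm_integral_le_of_norm_le ((int_mul_norm hd hχ).const_mul C)
              (Eventually.of_forall fun x => ?_)
            rw [norm_mul]
            exact mul_le_mul (hC k x) (norm_inner_le_norm _ _) (norm_nonneg _) hC0
        _ = C * ∫ x, (‖f k x - f0 x‖ * ‖χ x‖) := integral_const_mul _ _
        _ ≤ _ := mul_le_mul_of_nonneg_left (cs_aux hd hχ) hC0
    refine squeeze_zero_norm hb ?_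
    have := (((Real.continuous_sqrt.tendsto 0).comp hL).mul_const
      (√(∫ x, ‖χ x‖ ^ 2))).const_mul C
    simpa using this
  have h3 := h2.add h1
  rw [zero_add] at h3
  refine h3.congr fun k => ?_
  rw [← integral_add]
  · refine integral_congr_ae (Eventually.of_forall fun x => ?_)
    simp only [inner_sub_left]; ring
  · exact int_w_inner (hw k) (Eventually.of_forall (hC k)) ((hf k).sub hf0) hχ
  · exact int_w_inner (hw k) (Eventually.of_forall (hC k)) hf0 hχ

lemma grad_apply (f : Euc n → ℝ) (x : Euc n) (i : Fin n) :
    gradient f x i = fderiv ℝ f x (EuclideanSpace.single i 1) := by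
  rw [← inner_gradient_left, EuclideanSpace.inner_single_right]
  simp

lemma IsTestFun.grad_contDiff {Ω : Set (Euc n)} {φ : Euc n → ℝ} (h : IsTestFun Ω φ) :
    ContDiff ℝ (⊤ : ℕ∞) (gradient φ) := by
  have : ContDiff ℝ (⊤ : ℕ∞) (fderiv ℝ φ) := h.1.fderiv_right (by simp)
  exact (InnerProductSpace.toDual ℝ (Euc n)).symm.contDiff.comp this

lemma IsTestFun.grad_supp {Ω : Set (Euc n)} {φ : Euc n → ℝ} (h : IsTestFun Ω φ) :
    HasCompactSupport (gradient φ) := by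
  have := h.2.1.fderiv (𝕜 := ℝ)
  exact this.comp_left (g := (InnerProductSpace.toDual ℝ (Euc n)).symm) (by simp)

lemma IsTestFun.memLp {Ω : Set (Euc n)} {φ : Euc n → ℝ} (h : IsTestFun Ω φ) :
    MemLp φ 2 volume := h.1.continuous.memLp_of_hasCompactSupport h.2.1

lemma IsTestFun.grad_memLp {Ω : Set (Euc n)} {φ : Euc n → ℝ} (h : IsTestFun Ω φ) :
    MemLp (gradient φ) 2 volume :=
  h.grad_contDiff.continuous.memLp_of_hasCompactSupport h.grad_supp

lemma IsTestFun.d_contDiff {Ω : Set (Euc n)} {φ : Euc n → ℝ} (h : IsTestFun Ω φ) (v : Euc n) :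
    ContDiff ℝ (⊤ : ℕ∞) (fun y => fderiv ℝ φ y v) :=
  (h.1.fderiv_right (m := (⊤ : ℕ∞)) (by simp)).clm_apply contDiff_const

lemma IsTestFun.d_test {Ω : Set (Euc n)} {φ : Euc n → ℝ} (h : IsTestFun Ω φ) (v : Euc n) :
    IsTestFun Ω (fun y => fderiv ℝ φ y v) := by
  refine ⟨h.d_contDiff v, h.2.1.fderiv_apply (𝕜 := ℝ) v, ?_⟩
  exact (tsupport_fderiv_apply_subset ℝ v).trans h.2.2

lemma IsTestFun.lap_cont {Ω : Set (Euc n)} {φ : Euc n → ℝ} (h : IsTestFun Ω φ) :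
    Continuous (lap φ) := by
  unfold lap
  exact continuous_finsetSum _ fun i _ => ((h.d_test _).d_test _).1.continuous

lemma IsTestFun.lap_memLp {Ω : Set (Euc n)} {φ : Euc n → ℝ} (h : IsTestFun Ω φ) (p : ℝ≥0∞) :
    MemLp (lap φ) p volume := by
  unfold lap
  refine memLp_finsetSum _ fun i _ => ?_
  have := (h.d_test (EuclideanSpace.single i 1)).d_test (EuclideanSpace.single i 1)
  exact this.1.continuous.memLp_of_hasCompactSupport this.2.1

/-- Integration by parts for `C¹` functions. -/
lemma ibp {Ω : Set (Euc n)} {f χ : Euc n → ℝ} (hf : ContDiff ℝ 1 f) (hχ : IsTestFun Ω χ) :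
    ∫ x, f x * lap χ x = - ∫ x, inner ℝ (gradient f x) (gradient χ x) := by
  have hfd : ∀ i : Fin n, Continuous (fun x => fderiv ℝ f x (EuclideanSpace.single i 1)) :=
    fun i => (hf.continuous_fderiv (by simp)).clm_apply continuous_const
  have key : ∀ i : Fin n, ∫ x, f x * fderiv ℝ (fun y => fderiv ℝ χ y (EuclideanSpace.single i 1)) x
      (EuclideanSpace.single i 1) = - ∫ x, fderiv ℝ f x (EuclideanSpace.single i 1) *
        fderiv ℝ χ x (EuclideanSpace.single i 1) := by
    intro i
    have h1 := hχ.d_test (EuclideanSpace.single i 1)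
    have h2 := h1.d_test (EuclideanSpace.single i 1)
    refine integral_mul_fderiv_eq_neg_fderiv_mul_of_integrable ?_ ?_ ?_ ?_ ?_
    · exact ((hfd i).mul h1.1.continuous).integrable_of_hasCompactSupport h1.2.1.mul_left
    · exact (hf.continuous.mul h2.1.continuous).integrable_of_hasCompactSupport h2.2.1.mul_left
    · exact (hf.continuous.mul h1.1.continuous).integrable_of_hasCompactSupport h1.2.1.mul_left
    · exact fun x _ => hf.differentiable (by simp) x
    · exact fun x _ => h1.1.differentiable (by simp) x
  have e1 : ∀ x, inner ℝ (gradient f x) (gradient χ x) = ∑ i : Fin n,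
      fderiv ℝ f x (EuclideanSpace.single i 1) * fderiv ℝ χ x (EuclideanSpace.single i 1) := by
    intro x
    rw [PiLp.inner_apply]
    refine Finset.sum_congr rfl fun i _ => ?_
    rw [grad_apply, grad_apply]; simp [mul_comm]
  simp_rw [e1]
  unfold lap
  simp_rw [Finset.mul_sum]
  rw [integral_finsetSum, integral_finsetSum, ← Finset.sum_neg_distrib]
  · exact Finset.sum_congr rfl fun i _ => key i
  · intro i _
    have h1 := hχ.d_test (EuclideanSpace.single i 1)
    exact ((hfd i).mul h1.1.continuous).integrable_of_hasCompactSupport h1.2.1.mul_left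
  · intro i _
    have h2 := (hχ.d_test (EuclideanSpace.single i 1)).d_test (EuclideanSpace.single i 1)
    exact (hf.continuous.mul h2.1.continuous).integrable_of_hasCompactSupport h2.2.1.mul_left

lemma grad_comp {G : ℝ → ℝ} {φ : Euc n → ℝ} {x : Euc n} {g : ℝ} (hG : HasDerivAt G g (φ x))
    (hφ : DifferentiableAt ℝ φ x) :
    gradient (fun y => G (φ y)) x = g • gradient φ x := by
  have h := (hG.comp_hasFDerivAt x hφ.hasFDerivAt).fderiv
  unfold gradient
  change (InnerProductSpace.toDual ℝ (Euc n)).symm (fderiv ℝ (G ∘ φ) x) = _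
  rw [h]; simp

lemma grad_mul {f g : Euc n → ℝ} {x : Euc n} (hf : DifferentiableAt ℝ f x)
    (hg : DifferentiableAt ℝ g x) :
    gradient (fun y => f y * g y) x = f x • gradient g x + g x • gradient f x := by
  unfold gradient
  have : fderiv ℝ (fun y => f y * g y) x = _ := fderiv_mul hf hg
  rw [this]; simp

/-- extraction of an a.e. convergent subsequence -/
lemma MemH10.exists_seq {Ω : Set (Euc n)} {u : Euc n → ℝ} {Du : Euc n → Euc n}
    (h : MemH10 Ω u Du) : ∃ φ : ℕ → Euc n → ℝ, (∀ k, IsTestFun Ω (φ k)) ∧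
    Tendsto (fun k => ∫ x, (φ k x - u x) ^ 2) atTop (𝓝 0) ∧
    Tendsto (fun k => ∫ x, ‖gradient (φ k) x - Du x‖ ^ 2) atTop (𝓝 0) ∧
    ∀ᵐ x, Tendsto (fun k => φ k x) atTop (𝓝 (u x)) := by
  obtain ⟨hu, hDu, φ, h1, h2, h3⟩ := h
  have hm : TendstoInMeasure volume φ atTop u := by
    refine tendstoInMeasure_of_tendsto_eLpNorm (p := 2) (by simp) (fun k => (h1 k).memLp.1) hu.1 ?_
    have e : ∀ k, eLpNorm (φ k - u) 2 volume =
        ENNReal.ofReal ((∫ x, (φ k x - u x) ^ 2) ^ (1 / 2 : ℝ)) := by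
      intro k
      have hd : MemLp (φ k - u) 2 volume := (h1 k).memLp.sub hu
      rw [hd.eLpNorm_eq_integral_rpow_norm (by simp) (by simp)]
      simp
    simp_rw [e]
    rw [← ENNReal.ofReal_zero]
    refine (ENNReal.continuous_ofReal.tendsto 0).comp ?_
    have := ((Real.continuous_sqrt.tendsto 0).comp h2)
    simpa [Function.comp_def, Real.sqrt_eq_rpow] using this
  obtain ⟨ns, hns, hlim⟩ := hm.exists_seq_tendsto_ae
  exact ⟨fun k => φ (ns k), fun k => h1 _, h2.comp hns.tendsto_atTop,
    h3.comp hns.tendsto_atTop, hlim⟩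

lemma MemH10.zero_off {Ω : Set (Euc n)} {u : Euc n → ℝ} {Du : Euc n → Euc n}
    (h : MemH10 Ω u Du) : ∀ᵐ x, x ∉ Ω → u x = 0 := by
  obtain ⟨φ, h1, -, -, h4⟩ := h.exists_seq
  filter_upwards [h4] with x hx hxΩ
  have : ∀ k, φ k x = 0 := fun k => image_eq_zero_of_notMem_tsupport fun hh => hxΩ ((h1 k).2.2 hh)
  simp_rw [this] at hx
  exact (tendsto_nhds_unique hx tendsto_const_nhds)

/-- chain rule in weak form -/
lemma chain {Ω Ω' : Set (Euc n)} {u : Euc n → ℝ} {Du : Euc n → Euc n}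
    (h : MemH10 Ω u Du) {G g : ℝ → ℝ} {C : ℝ} (hG : ∀ s, HasDerivAt G (g s) s)
    (hg : Continuous g) (hC : ∀ s, |g s| ≤ C) {χ : Euc n → ℝ} (hχ : IsTestFun Ω' χ) :
    ∫ x, G (u x) * lap χ x = - ∫ x, g (u x) * inner ℝ (Du x) (gradient χ x) := by
  obtain ⟨φ, h1, h2, h3, h4⟩ := h.exists_seq
  obtain ⟨hu, hDu, -⟩ := h
  have hC0 : 0 ≤ C := (abs_nonneg _).trans (hC 0)
  have hGc : Continuous G := continuous_iff_continuousAt.2 fun s => (hG s).continuousAt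
  have hG1 : ContDiff ℝ 1 G := by
    rw [contDiff_one_iff_deriv]
    refine ⟨fun s => (hG s).differentiableAt, ?_⟩
    rwa [show deriv G = g from funext fun s => (hG s).deriv]
  have hlip : ∀ a b, |G a - G b| ≤ C * |a - b| := by
    intro a b
    have := Convex.norm_image_sub_le_of_norm_hasDerivWithin_le (f := G) (f' := g) (s := univ)
      (C := C) (x := b) (y := a) (fun s _ => (hG s).hasDerivWithinAt) (fun s _ => hC s)
      convex_univ (mem_univ _) (mem_univ _)
    simpa using this
  have hk : ∀ k, ∫ x, G (φ k x) * lap χ x =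
      - ∫ x, g (φ k x) * inner ℝ (gradient (φ k) x) (gradient χ x) := by
    intro k
    rw [ibp (f := fun x => G (φ k x)) (hG1.comp ((h1 k).1.of_le (by simp))) hχ]
    congr 1
    refine integral_congr_ae (Eventually.of_forall fun x => ?_)
    simp only
    rw [grad_comp (hG _) ((h1 k).1.differentiable (by simp) x), real_inner_smul_left]
  have lim1 : Tendsto (fun k => ∫ x, g (φ k x) * inner ℝ (gradient (φ k) x) (gradient χ x)) atTop
      (𝓝 (∫ x, g (u x) * inner ℝ (Du x) (gradient χ x))) := by
    refine tendsto_conv (C := C) (fun k => (h1 k).grad_memLp) hDu hχ.grad_memLp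
      (fun k => (hg.comp (h1 k).1.continuous).aestronglyMeasurable) (fun k x => hC _) ?_ h3
    filter_upwards [h4] with x hx
    exact (hg.tendsto _).comp hx
  have lim2 : Tendsto (fun k => ∫ x, G (φ k x) * lap χ x) atTop (𝓝 (∫ x, G (u x) * lap χ x)) := by
    have hint : Integrable (fun x => G (u x) * lap χ x) := by
      have hi : Integrable (fun x => (C * |u x|+ |G 0|) * |lap χ x|) := by
        have := ((int_mul_norm hu (hχ.lap_memLp 2)).const_mul C).add
          ((memLp_one_iff_integrable.1 (hχ.lap_memLp 1)).norm.const_mul |G 0|)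
        refine this.congr (Eventually.of_forall fun x => ?_)
        simp; ring
      refine hi.mono' ((hGc.comp_aestronglyMeasurable hu.1).mul
        hχ.lap_cont.aestronglyMeasurable) (Eventually.of_forall fun x => ?_)
      rw [norm_mul]
      refine mul_le_mul_of_nonneg_right ?_ (norm_nonneg _)
      have a1 := hlip (u x) 0
      have a2 : |G (u x)| ≤ |G (u x) - G 0| + |G 0| := by
        simpa using abs_add_le (G (u x) - G 0) (G 0)
      rw [sub_zero] at a1
      rw [Real.norm_eq_abs]; linarith
    have hintk : ∀ k, Integrable (fun x => G (φ k x) * lap χ x) := fun k => by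
      refine (hGc.comp (h1 k).1.continuous).mul hχ.lap_cont |>.integrable_of_hasCompactSupport ?_
      have : HasCompactSupport (lap χ) := by
        refine HasCompactSupport.of_support_subset_isCompact hχ.2.1 fun x hx => ?_
        by_contra hx'
        apply hx
        unfold lap
        refine Finset.sum_eq_zero fun i _ => ?_
        have h5 : IsTestFun (tsupport χ) χ := ⟨hχ.1, hχ.2.1, subset_rfl⟩
        have h6 := (h5.d_test (EuclideanSpace.single i 1)).d_test (EuclideanSpace.single i 1)
        exact image_eq_zero_of_notMem_tsupport (f := fun y => fderiv ℝ (fun y => fderiv ℝ χ y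
          (EuclideanSpace.single i 1)) y (EuclideanSpace.single i 1)) fun hh => hx' (h6.2.2 hh)
      exact this.mul_left
    have hz : Tendsto (fun k => ∫ x, (1 : ℝ) * inner ℝ (|φ k x - u x|) (|lap χ x|)) atTop
        (𝓝 (∫ x, (1 : ℝ) * inner ℝ (0 : ℝ) (|lap χ x|))) := by
      refine tendsto_conv (F := ℝ) (C := 1) (f := fun k x => |φ k x - u x|) (f0 := fun _ => 0)
        (χ := fun x => |lap χ x|) (w := fun _ _ => 1) (w0 := fun _ => 1)
        (fun k => ((h1 k).memLp.sub hu).abs) (MemLp.zero') (hχ.lap_memLp 2).abs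
        (fun k => aestronglyMeasurable_const) (by simp) (by simp) (by simpa using h2)
    rw [tendsto_iff_norm_sub_tendsto_zero]
    have hz2 := hz.const_mul C
    simp only [inner_zero_left, mul_zero, integral_zero] at hz2
    refine squeeze_zero (fun _ => norm_nonneg _) (fun k => ?_) hz2
    rw [← integral_sub (hintk k) hint, ← integral_const_mul]
    refine norm_integral_le_of_norm_le ?_ (Eventually.of_forall fun x => ?_)
    · refine ((int_mul_norm ((h1 k).memLp.sub hu) (hχ.lap_memLp 2)).const_mul C).congr
        (Eventually.of_forall fun x => ?_)
      simp [mul_comm]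
    · rw [← sub_mul, norm_mul]
      have := mul_le_mul_of_nonneg_right (hlip (φ k x) (u x)) (abs_nonneg (lap χ x))
      simp only [Real.norm_eq_abs, one_mul, RCLike.inner_apply, conj_trivial]
      linarith
  refine tendsto_nhds_unique lim2 ?_
  simp_rw [hk]
  exact lim1.neg

end helpers

section sub

variable {n : ℕ}

lemma dlim : Tendsto (fun m : ℕ => (1 / ((m : ℝ) + 1))) atTop (𝓝 0) :=
  tendsto_one_div_add_atTop_nhds_zero_nat

lemma sqrt_lim (s : ℝ) :
    Tendsto (fun m : ℕ => √(s ^ 2 + (1 / ((m : ℝ) + 1)) ^ 2)) atTop (𝓝 |s|) := by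
  have h : Continuous (fun d : ℝ => √(s ^ 2 + d ^ 2)) := by fun_prop
  have := (h.tendsto 0).comp dlim
  simpa [Function.comp_def, Real.sqrt_sq_eq_abs] using this

lemma abs_chain {Ω Ω' : Set (Euc n)} {u : Euc n → ℝ} {Du : Euc n → Euc n}
    (h : MemH10 Ω u Du) {χ : Euc n → ℝ} (hχ : IsTestFun Ω' χ) :
    ∫ x, |u x| * lap χ x = - ∫ x, (u x / |u x|) * inner ℝ (Du x) (gradient χ x) := by
  have hu := h.1
  have hDu := h.2.1
  have pos : ∀ (m : ℕ) (s : ℝ), 0 < s ^ 2 + (1 / ((m : ℝ) + 1)) ^ 2 := fun m s => by positivity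
  have bd : ∀ (m : ℕ) (s : ℝ), |s / √(s ^ 2 + (1 / ((m : ℝ) + 1)) ^ 2)| ≤ 1 := by
    intro m s
    rw [abs_div, abs_of_nonneg (Real.sqrt_nonneg _), div_le_one (Real.sqrt_pos.2 (pos m s))]
    apply Real.abs_le_sqrt
    have : 0 ≤ (1 / ((m : ℝ) + 1)) ^ 2 := by positivity
    linarith
  have cg : ∀ m : ℕ, Continuous (fun s : ℝ => s / √(s ^ 2 + (1 / ((m : ℝ) + 1)) ^ 2)) := fun m =>
    continuous_id.div (by fun_prop) fun s => (Real.sqrt_pos.2 (pos m s)).ne'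
  have hm : ∀ m : ℕ, ∫ x, √(u x ^ 2 + (1 / ((m : ℝ) + 1)) ^ 2) * lap χ x =
      - ∫ x, (u x / √(u x ^ 2 + (1 / ((m : ℝ) + 1)) ^ 2)) * inner ℝ (Du x) (gradient χ x) := by
    intro m
    refine chain h (G := fun s => √(s ^ 2 + (1 / ((m : ℝ) + 1)) ^ 2))
      (g := fun s => s / √(s ^ 2 + (1 / ((m : ℝ) + 1)) ^ 2)) (C := 1) ?_ (cg m) (bd m) hχ
    intro s
    have h1 : HasDerivAt (fun s : ℝ => s ^ 2 + (1 / ((m : ℝ) + 1)) ^ 2) (2 * s) s := by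
      simpa using (hasDerivAt_pow 2 s).add_const ((1 / ((m : ℝ) + 1)) ^ 2)
    convert! h1.sqrt (pos m s).ne' using 1
    rw [mul_div_mul_left _ _ (by norm_num)]
  have lim1 : Tendsto (fun m : ℕ => ∫ x, √(u x ^ 2 + (1 / ((m : ℝ) + 1)) ^ 2) * lap χ x) atTop
      (𝓝 (∫ x, |u x| * lap χ x)) := by
    refine tendsto_integral_of_dominated_convergence (fun x => (|u x| + 1) * |lap χ x|) ?_ ?_ ?_ ?_
    · intro m
      have : Continuous (fun s : ℝ => √(s ^ 2 + (1 / ((m : ℝ) + 1)) ^ 2)) := by fun_prop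
      exact (this.comp_aestronglyMeasurable hu.1).mul hχ.lap_cont.aestronglyMeasurable
    · have := ((int_mul_norm hu (hχ.lap_memLp 2))).add
          ((memLp_one_iff_integrable.1 (hχ.lap_memLp 1)).norm)
      refine this.congr (Eventually.of_forall fun x => ?_)
      simp; ring
    · intro m
      refine Eventually.of_forall fun x => ?_
      rw [norm_mul]
      refine mul_le_mul_of_nonneg_right ?_ (norm_nonneg _)
      rw [Real.norm_eq_abs, abs_of_nonneg (Real.sqrt_nonneg _), Real.sqrt_le_iff]
      refine ⟨by positivity, ?_⟩
      have h1 : (1 / ((m : ℝ) + 1)) ≤ 1 := by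
        rw [div_le_one (by positivity)]; linarith [(Nat.cast_nonneg m : (0 : ℝ) ≤ m)]
      have h0 : 0 ≤ (1 / ((m : ℝ) + 1)) := by positivity
      have := abs_nonneg (u x)
      nlinarith [sq_abs (u x)]
    · refine Eventually.of_forall fun x => (sqrt_lim (u x)).mul_const _
  have lim2 : Tendsto (fun m : ℕ => ∫ x, (u x / √(u x ^ 2 + (1 / ((m : ℝ) + 1)) ^ 2)) *
      inner ℝ (Du x) (gradient χ x)) atTop
      (𝓝 (∫ x, (u x / |u x|) * inner ℝ (Du x) (gradient χ x))) := by
    refine tendsto_conv (C := 1) (f := fun _ => Du) (fun _ => hDu) hDu hχ.grad_memLp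
      (fun m => (cg m).comp_aestronglyMeasurable hu.1) (fun m x => bd m _) ?_ (by simp)
    refine Eventually.of_forall fun x => ?_
    by_cases hx : u x = 0
    · simp [hx]
    · exact tendsto_const_nhds.div (sqrt_lim (u x)) (abs_ne_zero.2 hx)
  refine tendsto_nhds_unique lim1 ?_
  simp_rw [hm]
  exact lim2.neg

lemma sgn_bd (s : ℝ) : abs (s / |s|) ≤ 1 := by
  rw [abs_div, abs_abs]; exact div_self_le_one _

/-- The weak inequality extends to all test functions on the whole space. -/
lemma sub_whole {Ω : Set (Euc n)} {u : Euc n → ℝ} {Du : Euc n → Euc n} {lam : ℝ}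
    (h : MemH10 Ω u Du)
    (hsub : ∀ φ : Euc n → ℝ, IsTestFun Ω φ → (∀ x, 0 ≤ φ x) →
          -(lam * ∫ x, |u x| * φ x) ≤ ∫ x, |u x| * lap φ x)
    {ψ : Euc n → ℝ} (hψ : IsTestFun univ ψ) (hψ0 : ∀ x, 0 ≤ ψ x) :
    -(lam * ∫ x, |u x| * ψ x) ≤ ∫ x, |u x| * lap ψ x := by
  obtain ⟨φ, h1, h2, h3, h4⟩ := h.exists_seq
  have hu := h.1
  have hDu := h.2.1
  set V : Euc n → Euc n := fun x => (u x / |u x|) • Du x with hV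
  have hsm : AEStronglyMeasurable (fun x => u x / |u x|) volume :=
    (hu.1.aemeasurable.div hu.1.aemeasurable.abs).aestronglyMeasurable
  have hVm : MemLp V 2 volume := by
    refine hDu.mono (hsm.smul hDu.1) (Eventually.of_forall fun x => ?_)
    rw [hV, norm_smul]
    exact mul_le_of_le_one_left (norm_nonneg _) (sgn_bd _)
  have habs : MemLp (fun x => |u x|) 2 volume := hu.abs
  obtain ⟨B, hB⟩ : ∃ B, ∀ x, ‖ψ x‖ ≤ B := hψ.1.continuous.bounded_above_of_compact_support hψ.2.1
  have hB0 : 0 ≤ B := (norm_nonneg _).trans (hB 0)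
  -- the step at fixed ε
  have step : ∀ ε : ℝ, 0 < ε →
      ∫ x, (u x ^ 2 / (u x ^ 2 + ε ^ 2)) * inner ℝ (V x) (gradient ψ x) ≤
      lam * ∫ x, (u x ^ 2 / (u x ^ 2 + ε ^ 2)) * inner ℝ (|u x|) (ψ x) := by
    intro ε hε
    have pos : ∀ s : ℝ, 0 < s ^ 2 + ε ^ 2 := fun s => by positivity
    set H : ℝ → ℝ := fun s => s ^ 2 / (s ^ 2 + ε ^ 2) with hH
    set H' : ℝ → ℝ := fun s => 2 * s * ε ^ 2 / (s ^ 2 + ε ^ 2) ^ 2 with hH'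
    have Hsm : ContDiff ℝ (⊤ : ℕ∞) H :=
      (contDiff_id.pow 2).div ((contDiff_id.pow 2).add contDiff_const) fun s => (pos s).ne'
    have Hd : ∀ s, HasDerivAt H (H' s) s := by
      intro s
      have a1 : HasDerivAt (fun s : ℝ => s ^ 2) (2 * s) s := by simpa using hasDerivAt_pow 2 s
      have := a1.div (a1.add_const (ε ^ 2)) (pos s).ne'
      convert! this using 1
      simp only [hH']; congr 1; ring
    have H'c : Continuous H' := Continuous.div (by fun_prop) (by fun_prop)
      fun s => (pow_pos (pos s) 2).ne'
    have H0 : ∀ s, 0 ≤ H s := fun s => by simp only [hH]; positivity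
    have H1 : ∀ s, |H s| ≤ 1 := fun s => by
      rw [abs_of_nonneg (H0 s)]; simp only [hH]; rw [div_le_one (pos s)]; nlinarith
    have H'1 : ∀ s, |H' s| ≤ 1 / ε := by
      intro s
      have p := pos s
      simp only [hH']
      rw [abs_div, abs_of_pos (pow_pos p 2), div_le_div_iff₀ (by positivity) hε, abs_mul, abs_mul,
        abs_of_pos (pow_pos hε 2), abs_two]
      have q : 2 * |s| * ε ≤ s ^ 2 + ε ^ 2 := by nlinarith [sq_nonneg (|s| - ε), sq_abs s]
      have q2 : ε ^ 2 ≤ s ^ 2 + ε ^ 2 := by nlinarith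
      calc 2 * |s| * ε ^ 2 * ε = (2 * |s| * ε) * ε ^ 2 := by ring
        _ ≤ (s ^ 2 + ε ^ 2) * (s ^ 2 + ε ^ 2) := mul_le_mul q q2 (by positivity) p.le
        _ = _ := by ring
    have Hz : H 0 = 0 := by simp [hH]
    -- the test function
    have tf : ∀ k, IsTestFun Ω (fun x => ψ x * H (φ k x)) := by
      intro k
      have ss : Function.support (fun x => ψ x * H (φ k x)) ⊆ Function.support (φ k) := by
        intro x hx hx0
        apply hx
        simp only [hx0, Hz, mul_zero]
      have ts : tsupport (fun x => ψ x * H (φ k x)) ⊆ tsupport (φ k) := closure_mono ss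
      exact ⟨hψ.1.mul (Hsm.comp (h1 k).1),
        (h1 k).2.1.of_isClosed_subset (isClosed_tsupport _) ts, ts.trans (h1 k).2.2⟩
    have ineq : ∀ k, (∫ x, H (φ k x) * inner ℝ (gradient ψ x) (V x)) +
        ∫ x, (ψ x * H' (φ k x)) * inner ℝ (gradient (φ k) x) (V x) ≤
        lam * ∫ x, H (φ k x) * inner ℝ (ψ x) (|u x|) := by
      intro k
      have a := hsub _ (tf k) fun x => mul_nonneg (hψ0 x) (H0 _)
      rw [abs_chain h (tf k)] at a
      rw [← integral_add]
      · have e1 : ∫ x, |u x| * (ψ x * H (φ k x)) = ∫ x, H (φ k x) * inner ℝ (ψ x) (|u x|) := by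
          refine integral_congr_ae (Eventually.of_forall fun x => ?_)
          simp; ring
        rw [e1] at a
        have e2 : ∫ x, (u x / |u x|) * inner ℝ (Du x) (gradient (fun x => ψ x * H (φ k x)) x) =
          ∫ x, (H (φ k x) * inner ℝ (gradient ψ x) (V x) +
            (ψ x * H' (φ k x)) * inner ℝ (gradient (φ k) x) (V x)) := by
          refine integral_congr_ae (Eventually.of_forall fun x => ?_)
          simp only
          have d1 : DifferentiableAt ℝ (φ k) x := (h1 k).1.differentiable (by simp) x
          have d2 : DifferentiableAt ℝ ψ x := hψ.1.differentiable (by simp) x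
          rw [grad_mul (g := fun y => H (φ k y)) d2 ((Hd _).differentiableAt.comp x d1), grad_comp (Hd _) d1]
          simp only [hV, inner_add_right, real_inner_smul_right, real_inner_comm (Du x)]
          ring
        rw [e2] at a
        linarith
      · exact int_w_inner (C := 1) (Hsm.continuous.comp (h1 k).1.continuous).aestronglyMeasurable
          (Eventually.of_forall fun x => H1 _) hψ.grad_memLp hVm
      · refine int_w_inner (C := B * (1 / ε)) (hψ.1.continuous.mul
          (H'c.comp (h1 k).1.continuous)).aestronglyMeasurable
          (Eventually.of_forall fun x => ?_) (h1 k).grad_memLp hVm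
        rw [abs_mul]
        exact mul_le_mul (hB x) (H'1 _) (abs_nonneg _) hB0
    have l1 : Tendsto (fun k => ∫ x, H (φ k x) * inner ℝ (gradient ψ x) (V x)) atTop
        (𝓝 (∫ x, H (u x) * inner ℝ (gradient ψ x) (V x))) := by
      refine tendsto_conv (C := 1) (f := fun _ => gradient ψ) (fun _ => hψ.grad_memLp)
        hψ.grad_memLp hVm
        (fun k => (Hsm.continuous.comp (h1 k).1.continuous).aestronglyMeasurable)
        (fun k x => H1 _) ?_ (by simp)
      filter_upwards [h4] with x hx
      exact (Hsm.continuous.tendsto _).comp hx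
    have l2 : Tendsto (fun k => ∫ x, (ψ x * H' (φ k x)) * inner ℝ (gradient (φ k) x) (V x)) atTop
        (𝓝 (∫ x, (ψ x * H' (u x)) * inner ℝ (Du x) (V x))) := by
      refine tendsto_conv (C := B * (1 / ε)) (f := fun k => gradient (φ k))
        (fun k => (h1 k).grad_memLp) hDu hVm
        (fun k => (hψ.1.continuous.mul (H'c.comp (h1 k).1.continuous)).aestronglyMeasurable)
        (fun k x => ?_) ?_ h3
      · rw [abs_mul]
        exact mul_le_mul (hB x) (H'1 _) (abs_nonneg _) hB0
      · filter_upwards [h4] with x hx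
        exact ((H'c.tendsto _).comp hx).const_mul _
    have l3 : Tendsto (fun k => ∫ x, H (φ k x) * inner ℝ (ψ x) (|u x|)) atTop
        (𝓝 (∫ x, H (u x) * inner ℝ (ψ x) (|u x|))) := by
      refine tendsto_conv (F := ℝ) (C := 1) (f := fun _ => ψ) (χ := fun x => |u x|)
        (fun _ => hψ.memLp) hψ.memLp habs
        (fun k => (Hsm.continuous.comp (h1 k).1.continuous).aestronglyMeasurable)
        (fun k x => H1 _) ?_ (by simp)
      filter_upwards [h4] with x hx
      exact (Hsm.continuous.tendsto _).comp hx
    have l4 := le_of_tendsto_of_tendsto' (l1.add l2) (l3.const_mul lam) ineq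
    have nn : 0 ≤ ∫ x, (ψ x * H' (u x)) * inner ℝ (Du x) (V x) := by
      refine integral_nonneg fun x => ?_
      simp only [hV, hH', real_inner_smul_right, real_inner_self_eq_norm_sq]
      have p := pos (u x)
      have : ψ x * (2 * u x * ε ^ 2 / (u x ^ 2 + ε ^ 2) ^ 2) * (u x / |u x| * ‖Du x‖ ^ 2) =
        (ψ x * (2 * ε ^ 2 / (u x ^ 2 + ε ^ 2) ^ 2)) * ((u x * u x) / |u x| * ‖Du x‖ ^ 2) := by
        ring
      rw [this]
      have := hψ0 x
      have := mul_self_nonneg (u x)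
      positivity
    have e1 : ∀ x, inner ℝ (V x) (gradient ψ x) = inner ℝ (gradient ψ x) (V x) :=
      fun x => real_inner_comm _ _
    have e2 : ∀ x, inner ℝ (|u x|) (ψ x) = inner ℝ (ψ x) (|u x|) := fun x => real_inner_comm _ _
    simp_rw [e1, e2]
    simp only [hH] at l4
    linarith
  -- now ε → 0
  have pos : ∀ (m : ℕ) (s : ℝ), 0 < s ^ 2 + (1 / ((m : ℝ) + 1)) ^ 2 := fun m s => by positivity
  have bd : ∀ (m : ℕ) (s : ℝ), |s ^ 2 / (s ^ 2 + (1 / ((m : ℝ) + 1)) ^ 2)| ≤ 1 := by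
    intro m s
    rw [abs_of_nonneg (by positivity), div_le_one (pos m s)]
    have : 0 ≤ (1 / ((m : ℝ) + 1)) ^ 2 := by positivity
    linarith
  have cg : ∀ m : ℕ, Continuous (fun s : ℝ => s ^ 2 / (s ^ 2 + (1 / ((m : ℝ) + 1)) ^ 2)) :=
    fun m => Continuous.div (by fun_prop) (by fun_prop) fun s => (pos m s).ne'
  have lim : ∀ x, Tendsto (fun m : ℕ => u x ^ 2 / (u x ^ 2 + (1 / ((m : ℝ) + 1)) ^ 2)) atTop
      (𝓝 (u x ^ 2 / u x ^ 2)) := by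
    intro x
    by_cases hx : u x = 0
    · simp [hx]
    · have : Tendsto (fun m : ℕ => (u x ^ 2 + (1 / ((m : ℝ) + 1)) ^ 2)) atTop
        (𝓝 (u x ^ 2 + 0 ^ 2)) := (dlim.pow 2).const_add _
      rw [zero_pow two_ne_zero, add_zero] at this
      exact tendsto_const_nhds.div this (pow_ne_zero 2 hx)
  have L1 : Tendsto (fun m : ℕ => ∫ x, (u x ^ 2 / (u x ^ 2 + (1 / ((m : ℝ) + 1)) ^ 2)) *
      inner ℝ (V x) (gradient ψ x)) atTop
      (𝓝 (∫ x, (u x ^ 2 / u x ^ 2) * inner ℝ (V x) (gradient ψ x))) :=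
    tendsto_conv (C := 1) (f := fun _ => V) (fun _ => hVm) hVm hψ.grad_memLp
      (fun m => (cg m).comp_aestronglyMeasurable hu.1) (fun m x => bd m _)
      (Eventually.of_forall lim) (by simp)
  have L2 : Tendsto (fun m : ℕ => ∫ x, (u x ^ 2 / (u x ^ 2 + (1 / ((m : ℝ) + 1)) ^ 2)) *
      inner ℝ (|u x|) (ψ x)) atTop
      (𝓝 (∫ x, (u x ^ 2 / u x ^ 2) * inner ℝ (|u x|) (ψ x))) :=
    tendsto_conv (F := ℝ) (C := 1) (f := fun _ x => |u x|) (fun _ => habs) habs hψ.memLp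
      (fun m => (cg m).comp_aestronglyMeasurable hu.1) (fun m x => bd m _)
      (Eventually.of_forall lim) (by simp)
  have fin := le_of_tendsto_of_tendsto' L1 (L2.const_mul lam) fun m => step _ (by positivity)
  rw [abs_chain h hψ]
  have E1 : ∫ x, (u x ^ 2 / u x ^ 2) * inner ℝ (V x) (gradient ψ x) =
      ∫ x, (u x / |u x|) * inner ℝ (Du x) (gradient ψ x) := by
    refine integral_congr_ae (Eventually.of_forall fun x => ?_)
    simp only [hV, real_inner_smul_left]
    by_cases hx : u x = 0
    · simp [hx]
    · rw [div_self (pow_ne_zero 2 hx), one_mul]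
  have E2 : ∫ x, (u x ^ 2 / u x ^ 2) * inner ℝ (|u x|) (ψ x) = ∫ x, |u x| * ψ x := by
    refine integral_congr_ae (Eventually.of_forall fun x => ?_)
    by_cases hx : u x = 0
    · simp [hx]
    · simp [div_self (pow_ne_zero 2 hx), mul_comm]
  rw [E1, E2] at fin
  linarith

end sub

section eig

variable {n : ℕ}

lemma lam1_set_bdd (Ω : Set (Euc n)) : BddBelow {r | ∃ u Du, MemH10 Ω u Du ∧
    (∫ x, u x ^ 2) ≠ 0 ∧ r = (∫ x, ‖Du x‖ ^ 2) / (∫ x, u x ^ 2)} := by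
  refine ⟨0, ?_⟩
  rintro r ⟨u, Du, -, -, rfl⟩
  exact div_nonneg (integral_nonneg fun x => by positivity) (integral_nonneg fun x => by positivity)

lemma lam1_nonneg (Ω : Set (Euc n)) : 0 ≤ lam1 Ω := by
  refine Real.sInf_nonneg ?_
  rintro r ⟨u, Du, -, -, rfl⟩
  exact div_nonneg (integral_nonneg fun x => by positivity) (integral_nonneg fun x => by positivity)

lemma lam1_le {Ω : Set (Euc n)} {u : Euc n → ℝ} {Du : Euc n → Euc n} (h : MemH10 Ω u Du) :
    lam1 Ω * (∫ x, u x ^ 2) ≤ ∫ x, ‖Du x‖ ^ 2 := by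
  by_cases h0 : (∫ x, u x ^ 2) = 0
  · rw [h0, mul_zero]; exact integral_nonneg fun x => by positivity
  · have hp : 0 < ∫ x, u x ^ 2 :=
      lt_of_le_of_ne (integral_nonneg fun x => by positivity) (Ne.symm h0)
    rw [← le_div_iff₀ hp]
    exact csInf_le (lam1_set_bdd Ω) ⟨u, Du, h, h0, rfl⟩

lemma MemH10.add_test {Ω : Set (Euc n)} {u φ : Euc n → ℝ} {Du : Euc n → Euc n}
    (h : MemH10 Ω u Du) (hφ : IsTestFun Ω φ) (t : ℝ) :
    MemH10 Ω (fun x => u x + t * φ x) (fun x => Du x + t • gradient φ x) := by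
  obtain ⟨hu, hDu, ψ, h1, h2, h3⟩ := h
  refine ⟨hu.add (hφ.memLp.const_mul t), hDu.add (hφ.grad_memLp.const_smul t),
    fun k x => ψ k x + t * φ x, fun k => ?_, ?_, ?_⟩
  · have ss : tsupport (fun x => ψ k x + t * φ x) ⊆ tsupport (ψ k) ∪ tsupport φ := by
      rw [tsupport, tsupport, tsupport, ← closure_union]
      refine closure_mono fun x hx => ?_
      by_contra hh
      simp only [mem_union, Function.mem_support, not_or, not_not] at hh
      exact hx (by simp [hh.1, hh.2])
    exact ⟨(h1 k).1.add (contDiff_const.mul hφ.1),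
      ((h1 k).2.1.isCompact.union hφ.2.1.isCompact).of_isClosed_subset (isClosed_tsupport _) ss,
      ss.trans (union_subset (h1 k).2.2 hφ.2.2)⟩
  · simpa using h2
  · refine h3.congr fun k => ?_
    refine integral_congr_ae (Eventually.of_forall fun x => ?_)
    have d1 : DifferentiableAt ℝ (ψ k) x := (h1 k).1.differentiable (by simp) x
    have d2 : DifferentiableAt ℝ φ x := hφ.1.differentiable (by simp) x
    have : gradient (fun x => ψ k x + t * φ x) x = gradient (ψ k) x + t • gradient φ x := by
      unfold gradient
      rw [fderiv_fun_add d1 (d2.const_mul t), fderiv_const_mul d2]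
      simp
    simp only [this]
    congr 2
    abel

lemma quad_zero {a b : ℝ} (h : ∀ t : ℝ, 0 ≤ 2 * t * a + t ^ 2 * b) : a = 0 := by
  by_contra ha
  have hb : 0 ≤ b := by
    have h1 := h 1
    have h2 := h (-1)
    linarith
  have := h (-a / (b + 1))
  have hb1 : 0 < b + 1 := by linarith
  have e : 2 * (-a / (b + 1)) * a + (-a / (b + 1)) ^ 2 * b = -(a ^ 2 * (b + 2)) / (b + 1) ^ 2 := by
    field_simp; ring
  rw [e] at this
  have hp : 0 < a ^ 2 * (b + 2) / (b + 1) ^ 2 := by positivity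
  rw [neg_div] at this
  linarith

lemma eig_weak {Ω : Set (Euc n)} {u : Euc n → ℝ} {Du : Euc n → Euc n}
    (h : MemH10 Ω u Du) (h1 : (∫ x, u x ^ 2) = 1) (h2 : (∫ x, ‖Du x‖ ^ 2) = lam1 Ω)
    {φ : Euc n → ℝ} (hφ : IsTestFun Ω φ) :
    ∫ x, inner ℝ (Du x) (gradient φ x) = lam1 Ω * ∫ x, u x * φ x := by
  have hu := h.1
  have hDu := h.2.1
  have i1 : Integrable (fun x => u x ^ 2) := hu.integrable_sq
  have i2 : Integrable (fun x => φ x ^ 2) := hφ.memLp.integrable_sq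
  have i3 : Integrable (fun x => u x * φ x) := hu.integrable_mul hφ.memLp
  have i4 : Integrable (fun x => ‖Du x‖ ^ 2) := hDu.norm.integrable_sq
  have i5 : Integrable (fun x => ‖gradient φ x‖ ^ 2) := hφ.grad_memLp.norm.integrable_sq
  have i6 : Integrable (fun x => inner ℝ (Du x) (gradient φ x)) := by
    simpa using int_w_inner (w := fun _ => 1) (C := 1) aestronglyMeasurable_const (by simp)
      hDu hφ.grad_memLp
  have key : ∀ t : ℝ, 0 ≤ 2 * t * ((∫ x, inner ℝ (Du x) (gradient φ x)) -
      lam1 Ω * ∫ x, u x * φ x) + t ^ 2 * ((∫ x, ‖gradient φ x‖ ^ 2) -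
      lam1 Ω * ∫ x, φ x ^ 2) := by
    intro t
    have a := lam1_le (h.add_test hφ t)
    have e1 : ∫ x, (u x + t * φ x) ^ 2 = (∫ x, u x ^ 2) + 2 * t * (∫ x, u x * φ x) +
        t ^ 2 * ∫ x, φ x ^ 2 := by
      rw [← integral_const_mul, ← integral_const_mul, ← integral_add i1 (i3.const_mul _),
        ← integral_add (by exact i1.add (i3.const_mul _)) (i2.const_mul _)]
      refine integral_congr_ae (Eventually.of_forall fun x => ?_)
      simp only; ring
    have e2 : ∫ x, ‖Du x + t • gradient φ x‖ ^ 2 = (∫ x, ‖Du x‖ ^ 2) +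
        2 * t * (∫ x, inner ℝ (Du x) (gradient φ x)) + t ^ 2 * ∫ x, ‖gradient φ x‖ ^ 2 := by
      rw [← integral_const_mul, ← integral_const_mul, ← integral_add i4 (i6.const_mul _),
        ← integral_add (by exact i4.add (i6.const_mul _)) (i5.const_mul _)]
      refine integral_congr_ae (Eventually.of_forall fun x => ?_)
      simp only
      rw [norm_add_sq_real, real_inner_smul_right, norm_smul, mul_pow, Real.norm_eq_abs, sq_abs]
      ring
    rw [e1, e2, h1, h2] at a
    nlinarith
  linarith [quad_zero key]

lemma eig_sub {Ω : Set (Euc n)} {u : Euc n → ℝ} {Du : Euc n → Euc n}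
    (h : MemH10 Ω u Du) (h0 : ∀ᵐ x, 0 ≤ u x) (h1 : (∫ x, u x ^ 2) = 1)
    (h2 : (∫ x, ‖Du x‖ ^ 2) = lam1 Ω) (φ : Euc n → ℝ) (hφ : IsTestFun Ω φ) :
    -(lam1 Ω * ∫ x, |u x| * φ x) ≤ ∫ x, |u x| * lap φ x := by
  have e1 : ∫ x, |u x| * φ x = ∫ x, u x * φ x := by
    refine integral_congr_ae ?_
    filter_upwards [h0] with x hx
    rw [abs_of_nonneg hx]
  have e2 : ∫ x, |u x| * lap φ x = ∫ x, u x * lap φ x := by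
    refine integral_congr_ae ?_
    filter_upwards [h0] with x hx
    rw [abs_of_nonneg hx]
  have e3 := chain h (G := fun s => s) (g := fun _ => 1) (C := 1) (fun s => hasDerivAt_id s)
    continuous_const (by simp) hφ
  rw [e1, e2, e3, ← eig_weak h h1 h2 hφ]
  simp

end eig

section heat

variable {n : ℕ}

lemma lap_congr {f g : Euc n → ℝ} {x : Euc n} (h : f =ᶠ[𝓝 x] g) : lap f x = lap g x := by
  unfold lap
  refine Finset.sum_congr rfl fun i _ => ?_
  have : (fun y => fderiv ℝ f y (EuclideanSpace.single i 1)) =ᶠ[𝓝 x]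
      (fun y => fderiv ℝ g y (EuclideanSpace.single i 1)) := by
    filter_upwards [h.fderiv (𝕜 := ℝ)] with y hy
    rw [hy]
  rw [this.fderiv_eq]

lemma lap_gauss (b : ℝ) (x y : Euc n) :
    lap (fun y => Real.exp (-(b * ‖y - x‖ ^ 2))) y =
      (4 * b ^ 2 * ‖y - x‖ ^ 2 - 2 * b * n) * Real.exp (-(b * ‖y - x‖ ^ 2)) := by
  have d1 : ∀ y, HasFDerivAt (fun y : Euc n => Real.exp (-(b * ‖y - x‖ ^ 2)))
      (Real.exp (-(b * ‖y - x‖ ^ 2)) • -(b • ((2 : ℝ) • (innerSL ℝ (y - x) : Euc n →L[ℝ] ℝ)))) y := by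
    intro y
    have h0 : HasFDerivAt (fun y : Euc n => y - x) (ContinuousLinearMap.id ℝ (Euc n)) y :=
      (hasFDerivAt_id y).sub_const x
    have h1 := h0.norm_sq
    have h2 := ((h1.const_mul b).neg).exp
    refine h2.congr_fderiv ?_
    ext z; simp
  have e1 : ∀ i : Fin n, (fun y => fderiv ℝ (fun y : Euc n => Real.exp (-(b * ‖y - x‖ ^ 2))) y
      (EuclideanSpace.single i 1)) =
      fun y => Real.exp (-(b * ‖y - x‖ ^ 2)) * (-(2 * b) * (y i - x i)) := by
    intro i
    funext y
    rw [(d1 y).fderiv]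
    simp [EuclideanSpace.inner_single_right]
    ring
  have e2 : ∀ i : Fin n, fderiv ℝ (fun y => fderiv ℝ (fun y : Euc n =>
      Real.exp (-(b * ‖y - x‖ ^ 2))) y (EuclideanSpace.single i 1)) y (EuclideanSpace.single i 1) =
      Real.exp (-(b * ‖y - x‖ ^ 2)) * (4 * b ^ 2 * (y i - x i) ^ 2 - 2 * b) := by
    intro i
    rw [e1 i]
    have p : HasFDerivAt (fun y : Euc n => -(2 * b) * (y i - x i))
        (-(2 * b) • (EuclideanSpace.proj i : Euc n →L[ℝ] ℝ)) y :=
      (((EuclideanSpace.proj i : Euc n →L[ℝ] ℝ).hasFDerivAt).sub_const (x i)).const_mul _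
    have := ((d1 y).mul p).fderiv
    change fderiv ℝ ((fun y : Euc n => Real.exp (-(b * ‖y - x‖ ^ 2))) *
      (fun y : Euc n => -(2 * b) * (y i - x i))) y _ = _
    rw [this]
    simp [EuclideanSpace.inner_single_right]
    ring
  unfold lap
  simp_rw [e2]
  rw [← Finset.mul_sum, Finset.sum_sub_distrib, ← Finset.mul_sum]
  have : ∑ i : Fin n, (y i - x i) ^ 2 = ‖y - x‖ ^ 2 := by
    rw [EuclideanSpace.norm_sq_eq]
    simp
  rw [this]
  simp
  ring

/-- nonneg `L²` functions that are subsolutions on the whole space with bounded support -/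
structure Subsol (v : Euc n → ℝ) (lam R : ℝ) : Prop where
  nonneg : ∀ x, 0 ≤ v x
  memLp : MemLp v 2 volume
  one : ∫ x, v x ^ 2 = 1
  off : ∀ᵐ x, R ≤ ‖x‖ → v x = 0
  R0 : 0 < R
  lam0 : 0 ≤ lam
  sub : ∀ ψ : Euc n → ℝ, IsTestFun univ ψ → (∀ x, 0 ≤ ψ x) →
    -(lam * ∫ x, v x * ψ x) ≤ ∫ x, v x * lap ψ x

variable {v : Euc n → ℝ} {lam R : ℝ}

lemma Subsol.integrable (h : Subsol v lam R) : Integrable v := by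
  have hi : MemLp ((closedBall (0 : Euc n) R).indicator (fun _ => (1 : ℝ))) 2 volume :=
    memLp_indicator_const 2 measurableSet_closedBall 1
      (Or.inr (isCompact_closedBall (0 : Euc n) R).measure_lt_top.ne)
  refine (h.memLp.integrable_mul hi).congr ?_
  filter_upwards [h.off] with x hx
  by_cases hxR : x ∈ closedBall (0 : Euc n) R
  · simp [hxR]
  · have : R ≤ ‖x‖ := by simp at hxR; exact hxR.le
    simp [hx this]

lemma Subsol.gauss (h : Subsol v lam R) (b : ℝ) (x : Euc n) :
    -(lam * ∫ y, v y * Real.exp (-(b * ‖y - x‖ ^ 2))) ≤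
      ∫ y, v y * ((4 * b ^ 2 * ‖y - x‖ ^ 2 - 2 * b * n) * Real.exp (-(b * ‖y - x‖ ^ 2))) := by
  have hR := h.R0
  let f : ContDiffBump (0 : Euc n) := ⟨R, R + 1, hR, by linarith⟩
  have ht : IsTestFun univ (fun y => f y * Real.exp (-(b * ‖y - x‖ ^ 2))) := by
    refine ⟨f.contDiff.mul ?_, f.hasCompactSupport.mul_right, subset_univ _⟩
    have : ContDiff ℝ (⊤ : ℕ∞) (fun y : Euc n => ‖y - x‖ ^ 2) :=
      (contDiff_id.sub contDiff_const).norm_sq ℝ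
    exact (contDiff_const.mul this).neg.exp
  have a := h.sub _ ht fun y => mul_nonneg f.nonneg (Real.exp_pos _).le
  have e1 : ∫ y, v y * (f y * Real.exp (-(b * ‖y - x‖ ^ 2))) =
      ∫ y, v y * Real.exp (-(b * ‖y - x‖ ^ 2)) := by
    refine integral_congr_ae ?_
    filter_upwards [h.off] with y hy
    by_cases hyR : R ≤ ‖y‖
    · simp [hy hyR]
    · rw [f.one_of_mem_closedBall (by simp [f]; exact (not_le.1 hyR).le), one_mul]
  have e2 : ∫ y, v y * lap (fun y => f y * Real.exp (-(b * ‖y - x‖ ^ 2))) y =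
      ∫ y, v y * ((4 * b ^ 2 * ‖y - x‖ ^ 2 - 2 * b * n) * Real.exp (-(b * ‖y - x‖ ^ 2))) := by
    refine integral_congr_ae ?_
    filter_upwards [h.off] with y hy
    by_cases hyR : R ≤ ‖y‖
    · simp [hy hyR]
    · rw [← lap_gauss]
      congr 1
      apply lap_congr
      have : f =ᶠ[𝓝 y] 1 := f.eventuallyEq_one_of_mem_ball (by simp [f]; exact (not_le.1 hyR))
      filter_upwards [this] with z hz
      rw [hz]; simp
  rw [e1, e2] at a
  exact a

lemma Subsol.int_exp (h : Subsol v lam R) {b : ℝ} (hb : 0 ≤ b) (x : Euc n) :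
    Integrable (fun y => v y * Real.exp (-(b * ‖y - x‖ ^ 2))) := by
  refine h.integrable.mul_bdd (c := 1) (by fun_prop) (Eventually.of_forall fun y => ?_)
  rw [Real.norm_eq_abs, Real.abs_exp, Real.exp_le_one_iff]
  have : 0 ≤ b * ‖y - x‖ ^ 2 := by positivity
  linarith

lemma Subsol.int_sq_exp (h : Subsol v lam R) {b : ℝ} (hb : 0 ≤ b) (x : Euc n) :
    Integrable (fun y => v y * (‖y - x‖ ^ 2 * Real.exp (-(b * ‖y - x‖ ^ 2)))) := by
  refine (h.integrable.mul_const ((R + ‖x‖) ^ 2)).mono'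
    (h.memLp.1.mul (Continuous.aestronglyMeasurable (by fun_prop))) ?_
  filter_upwards [h.off] with y hy
  by_cases hyR : R ≤ ‖y‖
  · simp [hy hyR]
  · have h1 : ‖y - x‖ ≤ R + ‖x‖ := (norm_sub_le y x).trans (by linarith [not_le.1 hyR])
    have h2 : Real.exp (-(b * ‖y - x‖ ^ 2)) ≤ 1 := by
      rw [Real.exp_le_one_iff]
      have : 0 ≤ b * ‖y - x‖ ^ 2 := by positivity
      linarith
    have h3 : ‖y - x‖ ^ 2 ≤ (R + ‖x‖) ^ 2 := pow_le_pow_left₀ (norm_nonneg _) h1 2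
    rw [norm_mul, Real.norm_eq_abs, abs_of_nonneg (h.nonneg y), Real.norm_eq_abs,
      abs_of_nonneg (by positivity)]
    refine mul_le_mul_of_nonneg_left ?_ (h.nonneg y)
    calc _ ≤ ‖y - x‖ ^ 2 * 1 := by gcongr
      _ ≤ _ := by rwa [mul_one]

lemma Subsol.deriv_J (h : Subsol v lam R) (x : Euc n) {c : ℝ} (hc : 0 < c) :
    HasDerivAt (fun c : ℝ => ∫ y, v y * Real.exp (-(c ^ 2 / 4 * ‖y - x‖ ^ 2)))
      (∫ y, v y * (-(c / 2) * (‖y - x‖ ^ 2 * Real.exp (-(c ^ 2 / 4 * ‖y - x‖ ^ 2))))) c := by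
  refine (hasDerivAt_integral_of_dominated_loc_of_deriv_le
    (F := fun (c : ℝ) y => v y * Real.exp (-(c ^ 2 / 4 * ‖y - x‖ ^ 2)))
    (F' := fun (c : ℝ) y => v y * (-(c / 2) * (‖y - x‖ ^ 2 *
      Real.exp (-(c ^ 2 / 4 * ‖y - x‖ ^ 2)))))
    (bound := fun y => v y * ((c + 1) / 2 * (R + ‖x‖) ^ 2))
    (s := ball c 1) (ball_mem_nhds c one_pos) ?_ ?_ ?_ ?_ ?_ ?_).2
  · exact Eventually.of_forall fun c => (h.int_exp (by positivity) x).1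
  · exact h.int_exp (by positivity) x
  · exact h.memLp.1.mul (Continuous.aestronglyMeasurable (by fun_prop))
  · filter_upwards [h.off] with y hy c' hc'
    by_cases hyR : R ≤ ‖y‖
    · simp [hy hyR]
    · have h1 : ‖y - x‖ ≤ R + ‖x‖ := (norm_sub_le y x).trans (by linarith [not_le.1 hyR])
      have h2 : Real.exp (-(c' ^ 2 / 4 * ‖y - x‖ ^ 2)) ≤ 1 := by
        rw [Real.exp_le_one_iff]
        have : 0 ≤ c' ^ 2 / 4 * ‖y - x‖ ^ 2 := by positivity
        linarith
      have h3 : ‖y - x‖ ^ 2 ≤ (R + ‖x‖) ^ 2 := pow_le_pow_left₀ (norm_nonneg _) h1 2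
      have h4 : |c'| ≤ c + 1 := by
        rw [mem_ball, Real.dist_eq, abs_lt] at hc'
        rw [abs_le]; constructor <;> linarith [hc'.1, hc'.2]
      rw [norm_mul, Real.norm_eq_abs, abs_of_nonneg (h.nonneg y), norm_mul, Real.norm_eq_abs,
        abs_neg, abs_div, abs_two, Real.norm_eq_abs, 
        abs_of_nonneg (by positivity : 0 ≤ ‖y - x‖ ^ 2 * Real.exp (-(c' ^ 2 / 4 * ‖y - x‖ ^ 2)))]
      refine mul_le_mul_of_nonneg_left ?_ (h.nonneg y)
      refine mul_le_mul (by linarith) ?_ (by positivity) (by positivity)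
      calc _ ≤ ‖y - x‖ ^ 2 * 1 := by gcongr
        _ ≤ _ := by rwa [mul_one]
  · exact h.integrable.mul_const _
  · refine Eventually.of_forall fun y c' _ => ?_
    have a1 : HasDerivAt (fun s : ℝ => s ^ 2) (2 * c') c' := by simpa using hasDerivAt_pow 2 c'
    have := ((((a1.div_const 4).mul_const (‖y - x‖ ^ 2)).neg).exp).const_mul (v y)
    refine this.congr_deriv ?_
    simp only [Pi.neg_apply]; ring

lemma Subsol.anti (h : Subsol v lam R) (x : Euc n) :
    AntitoneOn (fun c : ℝ => (Real.exp (lam / c ^ 2) * c ^ n) *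
      ∫ y, v y * Real.exp (-(c ^ 2 / 4 * ‖y - x‖ ^ 2))) (Ioi 0) := by
  have hd : ∀ c : ℝ, 0 < c → HasDerivAt (fun c : ℝ => (Real.exp (lam / c ^ 2) * c ^ n) *
      ∫ y, v y * Real.exp (-(c ^ 2 / 4 * ‖y - x‖ ^ 2)))
      ((Real.exp (lam / c ^ 2) * c ^ n) * (-(2 * lam) / c ^ 3 + n / c) *
        (∫ y, v y * Real.exp (-(c ^ 2 / 4 * ‖y - x‖ ^ 2))) + (Real.exp (lam / c ^ 2) * c ^ n) *
        (∫ y, v y * (-(c / 2) * (‖y - x‖ ^ 2 * Real.exp (-(c ^ 2 / 4 * ‖y - x‖ ^ 2)))))) c := by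
    intro c hc
    refine HasDerivAt.mul ?_ (h.deriv_J x hc)
    have a1 : HasDerivAt (fun s : ℝ => s ^ 2) (2 * c) c := by simpa using hasDerivAt_pow 2 c
    have a2 := (((hasDerivAt_const c lam).div a1 (by positivity)).exp).mul (hasDerivAt_pow n c)
    refine a2.congr_deriv ?_
    simp only [Pi.div_apply]
    rcases n with _ | m
    · simp; field_simp; try ring
    · simp only [Nat.add_sub_cancel]
      field_simp
      try ring
  have conv : Convex ℝ (Ioi (0 : ℝ)) := convex_Ioi 0
  refine antitoneOn_of_deriv_nonpos conv
    (fun c hc => (hd c hc).continuousAt.continuousWithinAt) 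
    (fun c hc => ?_) (fun c hc => ?_)
  · rw [interior_Ioi] at hc
    exact (hd c hc).differentiableAt.differentiableWithinAt
  · rw [interior_Ioi] at hc
    have hc0 : 0 < c := hc
    rw [(hd c hc).deriv]
    have g := h.gauss (c ^ 2 / 4) x
    set J := ∫ y, v y * Real.exp (-(c ^ 2 / 4 * ‖y - x‖ ^ 2)) with hJ
    set Q := ∫ y, v y * (‖y - x‖ ^ 2 * Real.exp (-(c ^ 2 / 4 * ‖y - x‖ ^ 2))) with hQ
    have e1 : ∫ y, v y * (-(c / 2) * (‖y - x‖ ^ 2 * Real.exp (-(c ^ 2 / 4 * ‖y - x‖ ^ 2)))) =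
        -(c / 2) * Q := by
      rw [hQ, ← integral_const_mul]
      congr 1; funext y; ring
    have e2 : ∫ y, v y * ((4 * (c ^ 2 / 4) ^ 2 * ‖y - x‖ ^ 2 - 2 * (c ^ 2 / 4) * n) *
        Real.exp (-(c ^ 2 / 4 * ‖y - x‖ ^ 2))) = c ^ 4 / 4 * Q - c ^ 2 * n / 2 * J := by
      rw [hQ, hJ, ← integral_const_mul, ← integral_const_mul, ← integral_sub]
      · congr 1; funext y; ring
      · exact (h.int_sq_exp (by positivity) x).const_mul _
      · exact (h.int_exp (by positivity) x).const_mul _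
    rw [e2] at g
    rw [e1]
    have : (Real.exp (lam / c ^ 2) * c ^ n) * (-(2 * lam) / c ^ 3 + n / c) * J +
        (Real.exp (lam / c ^ 2) * c ^ n) * (-(c / 2) * Q) =
        -((Real.exp (lam / c ^ 2) * c ^ n) * (2 / c ^ 3) *
          (lam * J + (c ^ 4 / 4 * Q - c ^ 2 * n / 2 * J))) := by
      field_simp
      ring
    rw [this, neg_nonpos]
    have : 0 ≤ lam * J + (c ^ 4 / 4 * Q - c ^ 2 * n / 2 * J) := by linarith
    positivity

lemma int_gauss (b : ℝ) (hb : 0 < b) (x : Euc n) :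
    ∫ y : Euc n, Real.exp (-(b * ‖y - x‖ ^ 2)) = (Real.pi / b) ^ ((n : ℝ) / 2) := by
  have := GaussianFourier.integral_rexp_neg_mul_sq_norm (V := Euc n) hb
  rw [finrank_euclideanSpace_fin] at this
  rw [← this, ← integral_sub_right_eq_self (fun v : Euc n => Real.exp (-b * ‖v‖ ^ 2)) x]
  simp

lemma integrable_gauss (b : ℝ) (hb : 0 < b) (x : Euc n) :
    Integrable (fun y : Euc n => Real.exp (-(b * ‖y - x‖ ^ 2))) := by
  apply Integrable.of_integral_ne_zero
  rw [int_gauss b hb x]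
  positivity

lemma Subsol.kernel_bd (h : Subsol v lam R) (x : Euc n) {c : ℝ} (hc : 1 ≤ c) :
    c ^ n * ∫ y, v y * Real.exp (-(c ^ 2 / 4 * ‖y - x‖ ^ 2)) ≤
      Real.exp lam * (2 * Real.pi) ^ ((n : ℝ) / 4) := by
  have hc0 : 0 < c := by linarith
  have a := h.anti x (mem_Ioi.2 one_pos) (mem_Ioi.2 hc0) hc
  simp only [one_pow, div_one, mul_one] at a
  have J0 : 0 ≤ ∫ y, v y * Real.exp (-(c ^ 2 / 4 * ‖y - x‖ ^ 2)) :=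
    integral_nonneg fun y => mul_nonneg (h.nonneg y) (Real.exp_pos _).le
  have b1 : 1 ≤ Real.exp (lam / c ^ 2) := Real.one_le_exp (div_nonneg h.lam0 (by positivity))
  have b2 : c ^ n * ∫ y, v y * Real.exp (-(c ^ 2 / 4 * ‖y - x‖ ^ 2)) ≤
      Real.exp (lam / c ^ 2) * c ^ n * ∫ y, v y * Real.exp (-(c ^ 2 / 4 * ‖y - x‖ ^ 2)) := by
    rw [mul_assoc]
    exact le_mul_of_one_le_left (by positivity) b1
  refine b2.trans (a.trans ?_)
  refine mul_le_mul_of_nonneg_left ?_ (Real.exp_pos _).le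
  have sq : ∀ y : Euc n, Real.exp (-(1 / 4 * ‖y - x‖ ^ 2)) ^ 2 =
      Real.exp (-(1 / 2 * ‖y - x‖ ^ 2)) := fun y => by
    rw [← Real.exp_nat_mul]; congr 1; push_cast; ring
  have m : MemLp (fun y : Euc n => Real.exp (-(1 / 4 * ‖y - x‖ ^ 2))) 2 volume := by
    rw [memLp_two_iff_integrable_sq (Continuous.aestronglyMeasurable (by fun_prop))]
    simp_rw [sq]
    exact integrable_gauss _ (by norm_num) x
  have c := cs_aux h.memLp m
  simp only [Real.norm_eq_abs, sq_abs, Real.abs_exp, sq] at c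
  rw [h.one, int_gauss _ (by norm_num) x, Real.sqrt_one, one_mul, Real.sqrt_eq_rpow,
    ← Real.rpow_mul (by positivity)] at c
  have e : ∀ y, |v y| = v y := fun y => abs_of_nonneg (h.nonneg y)
  simp_rw [e] at c
  have e2 : (Real.pi / (1 / 2)) ^ ((n : ℝ) / 2 * (1 / 2)) = (2 * Real.pi) ^ ((n : ℝ) / 4) := by
    congr 1 <;> ring
  rw [e2] at c
  exact c

end heat

section final

variable {n : ℕ} {v : Euc n → ℝ} {lam R : ℝ}

/-- heat kernel at time one -/
def hk (n : ℕ) (z : Euc n) : ℝ := (4 * Real.pi) ^ (-(n : ℝ) / 2) * Real.exp (-(1 / 4 * ‖z‖ ^ 2))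

lemma hk_nonneg (z : Euc n) : 0 ≤ hk n z := by unfold hk; positivity

lemma hk_cont : Continuous (hk n) := by unfold hk; fun_prop

lemma hk_int : ∫ z, hk n z = 1 := by
  unfold hk
  have h := int_gauss (n := n) (1 / 4) (by norm_num) 0
  simp only [sub_zero] at h
  rw [integral_const_mul, h, show Real.pi / (1 / 4) = 4 * Real.pi by ring,
    ← Real.rpow_add (by positivity), show -(n : ℝ) / 2 + n / 2 = 0 by ring, Real.rpow_zero]

lemma hk_decay : Tendsto (fun x : Euc n => ‖x‖ ^ (Module.finrank ℝ (Euc n)) * hk n x)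
    (cobounded (Euc n)) (𝓝 0) := by
  have h1 : Tendsto (fun s : ℝ => s ^ n * Real.exp (-s)) atTop (𝓝 0) :=
    Real.tendsto_pow_mul_exp_neg_atTop_nhds_zero n
  have h2 : Tendsto (fun x : Euc n => (‖x‖ / 4)) (cobounded (Euc n)) atTop :=
    tendsto_norm_cobounded_atTop.atTop_div_const (by norm_num)
  have h3 := ((h1.comp h2).const_mul (4 ^ n * (4 * Real.pi) ^ (-(n : ℝ) / 2)))
  rw [mul_zero] at h3
  refine squeeze_zero' (Eventually.of_forall fun x => mul_nonneg (by positivity) (hk_nonneg x))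
    ?_ h3
  filter_upwards [tendsto_norm_cobounded_atTop.eventually_ge_atTop (1 : ℝ)] with x hx
  rw [finrank_euclideanSpace_fin]
  unfold hk
  simp only [Function.comp]
  have : Real.exp (-(1 / 4 * ‖x‖ ^ 2)) ≤ Real.exp (-(‖x‖ / 4)) := by
    rw [Real.exp_le_exp]; nlinarith
  calc ‖x‖ ^ n * ((4 * Real.pi) ^ (-(n : ℝ) / 2) * Real.exp (-(1 / 4 * ‖x‖ ^ 2)))
      ≤ ‖x‖ ^ n * ((4 * Real.pi) ^ (-(n : ℝ) / 2) * Real.exp (-(‖x‖ / 4))) := by gcongr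
    _ = _ := by rw [div_pow]; field_simp

lemma hk_scaled_int {c : ℝ} (hc : 0 < c) (x : Euc n) :
    ∫ z, c ^ n * hk n (c • (x - z)) = 1 := by
  rw [integral_const_mul, integral_sub_left_eq_self (fun z => hk n (c • z)) volume x,
    Measure.integral_comp_smul, hk_int, finrank_euclideanSpace_fin]
  rw [abs_of_pos (by positivity), smul_eq_mul, mul_one, mul_inv_cancel₀ (by positivity)]

lemma hk_scaled_integrable {c : ℝ} (hc : 0 < c) (x : Euc n) :
    Integrable (fun z => c ^ n * hk n (c • (x - z))) := by
  apply Integrable.of_integral_ne_zero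
  rw [hk_scaled_int hc x]; exact one_ne_zero

lemma const_eq : (4 * Real.pi) ^ (-(n : ℝ) / 2) * (2 * Real.pi) ^ ((n : ℝ) / 4) =
    (8 * Real.pi) ^ (-(n : ℝ) / 4) := by
  have h4 : (4 * Real.pi) ^ (-(n : ℝ) / 2) = ((4 * Real.pi) ^ 2) ^ (-(n : ℝ) / 4) := by
    rw [← Real.rpow_natCast, ← Real.rpow_mul (by positivity)]
    congr 1; push_cast; ring
  have h2 : (2 * Real.pi) ^ ((n : ℝ) / 4) = ((2 * Real.pi)⁻¹) ^ (-(n : ℝ) / 4) := by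
    rw [Real.inv_rpow (by positivity), ← Real.rpow_neg (by positivity)]
    congr 1; ring
  rw [h4, h2, ← Real.mul_rpow (by positivity) (by positivity)]
  congr 1
  field_simp
  ring

lemma Subsol.hk_bd (h : Subsol v lam R) (x : Euc n) {c : ℝ} (hc : 1 ≤ c) :
    ∫ y, v y * (c ^ n * hk n (c • (y - x))) ≤ Real.exp lam * (8 * Real.pi) ^ (-(n : ℝ) / 4) := by
  have a := mul_le_mul_of_nonneg_left (h.kernel_bd x hc)
    (by positivity : 0 ≤ (4 * Real.pi) ^ (-(n : ℝ) / 2))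
  have e : ∫ y, v y * (c ^ n * hk n (c • (y - x))) = (4 * Real.pi) ^ (-(n : ℝ) / 2) *
      (c ^ n * ∫ y, v y * Real.exp (-(c ^ 2 / 4 * ‖y - x‖ ^ 2))) := by
    rw [← integral_const_mul, ← integral_const_mul]
    refine integral_congr_ae (Eventually.of_forall fun y => ?_)
    simp only [hk, norm_smul, mul_pow, Real.norm_eq_abs, sq_abs]
    rw [show 1 / 4 * (c ^ 2 * ‖y - x‖ ^ 2) = c ^ 2 / 4 * ‖y - x‖ ^ 2 by ring]
    ring
  rw [e, ← const_eq]
  linarith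

lemma Subsol.test_bd (h : Subsol v lam R) {η : Euc n → ℝ} (hη : Continuous η)
    (hc : HasCompactSupport η) (h0 : ∀ x, 0 ≤ η x) (h1 : ∫ x, η x = 1) :
    ∫ y, η y * v y ≤ Real.exp lam * (8 * Real.pi) ^ (-(n : ℝ) / 4) := by
  have hηi : Integrable η := hη.integrable_of_hasCompactSupport hc
  obtain ⟨B, hB⟩ := hη.bounded_above_of_compact_support hc
  have lim : Tendsto (fun c : ℝ => ∫ y, v y * ∫ x, (c ^ n * hk n (c • (y - x))) * η x) atTop
      (𝓝 (∫ y, v y * η y)) := by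
    refine tendsto_integral_filter_of_dominated_convergence (fun y => v y * B) ?_ ?_
      (h.integrable.mul_const B) ?_
    · filter_upwards [eventually_gt_atTop (0 : ℝ)] with c hc
      refine h.memLp.1.mul ?_
      have : StronglyMeasurable (fun p : Euc n × Euc n => (c ^ n * hk n (c • (p.1 - p.2))) * η p.2) := by
        refine Continuous.stronglyMeasurable ?_
        have := hk_cont (n := n)
        fun_prop
      exact this.integral_prod_right.aestronglyMeasurable
    · filter_upwards [eventually_gt_atTop (0 : ℝ)] with c hc
      refine Eventually.of_forall fun y => ?_
      rw [norm_mul, Real.norm_eq_abs, abs_of_nonneg (h.nonneg y)]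
      refine mul_le_mul_of_nonneg_left ?_ (h.nonneg y)
      calc ‖∫ x, (c ^ n * hk n (c • (y - x))) * η x‖
          ≤ ∫ x, (c ^ n * hk n (c • (y - x))) * B := by
            refine norm_integral_le_of_norm_le ((hk_scaled_integrable hc y).mul_const B)
              (Eventually.of_forall fun x => ?_)
            have p : 0 ≤ c ^ n * hk n (c • (y - x)) := mul_nonneg (by positivity) (hk_nonneg _)
            rw [norm_mul, Real.norm_eq_abs, abs_of_nonneg p]
            exact mul_le_mul_of_nonneg_left (hB x) p
        _ = B := by rw [integral_mul_const, hk_scaled_int hc, one_mul]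
    · refine Eventually.of_forall fun y => ?_
      have := tendsto_integral_comp_smul_smul_of_integrable' (μ := (volume : Measure (Euc n)))
        (φ := hk n) hk_nonneg hk_int hk_decay (g := η) (x₀ := y) hηi hη.continuousAt
      simp only [finrank_euclideanSpace_fin, smul_eq_mul] at this
      exact this.const_mul _
  have e : ∫ y, η y * v y = ∫ y, v y * η y := by simp_rw [mul_comm]
  rw [e]
  refine le_of_tendsto lim ?_
  filter_upwards [eventually_ge_atTop (1 : ℝ)] with c hc1
  have hc0 : 0 < c := by linarith
  have kb : ∀ z, hk n z ≤ (4 * Real.pi) ^ (-(n : ℝ) / 2) := fun z => by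
    unfold hk
    refine mul_le_of_le_one_right (by positivity) ?_
    rw [Real.exp_le_one_iff]
    have : 0 ≤ 1 / 4 * ‖z‖ ^ 2 := by positivity
    linarith
  have hint : Integrable (fun p : Euc n × Euc n =>
      v p.1 * ((c ^ n * hk n (c • (p.1 - p.2))) * η p.2)) (volume.prod volume) := by
    have := (h.integrable.mul_prod hηi).bdd_mul
      (f := fun p : Euc n × Euc n => c ^ n * hk n (c • (p.1 - p.2)))
      (c := c ^ n * (4 * Real.pi) ^ (-(n : ℝ) / 2))
      (Continuous.aestronglyMeasurable (by have := hk_cont (n := n); fun_prop))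
      (Eventually.of_forall fun p => by
        rw [norm_mul, Real.norm_eq_abs, Real.norm_eq_abs, abs_of_pos (by positivity),
          abs_of_nonneg (hk_nonneg _)]
        exact mul_le_mul_of_nonneg_left (kb _) (by positivity))
    refine this.congr (Eventually.of_forall fun p => ?_)
    simp only; ring
  have sw : ∫ y, v y * ∫ x, (c ^ n * hk n (c • (y - x))) * η x =
      ∫ x, (∫ y, v y * (c ^ n * hk n (c • (y - x)))) * η x := by
    simp_rw [← integral_const_mul]
    rw [integral_integral_swap hint]
    refine integral_congr_ae (Eventually.of_forall fun x => ?_)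
    simp only
    rw [← integral_mul_const]
    refine integral_congr_ae (Eventually.of_forall fun y => ?_)
    simp only; ring
  rw [sw]
  have hint2 : Integrable (fun x => (∫ y, v y * (c ^ n * hk n (c • (y - x)))) * η x) := by
    refine hint.integral_prod_right.congr (Eventually.of_forall fun x => ?_)
    simp only
    rw [← integral_mul_const]
    refine integral_congr_ae (Eventually.of_forall fun y => ?_)
    simp only; ring
  calc _ ≤ ∫ x, (Real.exp lam * (8 * Real.pi) ^ (-(n : ℝ) / 4)) * η x :=
        integral_mono hint2 (hηi.const_mul _) fun x =>
          mul_le_mul_of_nonneg_right (h.hk_bd x hc1) (h0 x)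
    _ = _ := by rw [integral_const_mul, h1, mul_one]

lemma Subsol.ae_bd (h : Subsol v lam R) :
    ∀ᵐ x, v x ≤ Real.exp lam * (8 * Real.pi) ^ (-(n : ℝ) / 4) := by
  let f : ℕ → ContDiffBump (0 : Euc n) := fun m =>
    ⟨1 / ((m : ℝ) + 1), 2 * (1 / ((m : ℝ) + 1)), by positivity, by
      have : 0 < 1 / ((m : ℝ) + 1) := by positivity
      linarith⟩
  have key := ContDiffBump.ae_convolution_tendsto_right_of_locallyIntegrable
    (μ := (volume : Measure (Euc n))) (φ := f) (l := atTop) (K := 2) (g := v)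
    (by simpa [f] using dlim.const_mul 2) (Eventually.of_forall fun m => le_rfl)
    h.integrable.locallyIntegrable
  filter_upwards [key] with x hx
  refine le_of_tendsto' hx fun m => ?_
  rw [convolution_eq_swap]
  simp only [ContinuousLinearMap.lsmul_apply, smul_eq_mul]
  refine h.test_bd (η := fun t => (f m).normed volume (x - t)) ?_ ?_ ?_ ?_
  · exact (f m).continuous_normed.comp (by fun_prop)
  · exact (f m).hasCompactSupport_normed.comp_homeomorph (Homeomorph.subLeft x)
  · exact fun t => (f m).nonneg_normed _
  · rw [integral_sub_left_eq_self (fun z => (f m).normed volume z) volume x]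
    exact (f m).integral_normed

lemma main_part {Ω : Set (Euc n)} (hΩb : IsBounded Ω) {lam : ℝ} (hl : 0 ≤ lam)
    {u : Euc n → ℝ} {Du : Euc n → Euc n} (h : MemH10 Ω u Du) (h1 : (∫ x, u x ^ 2) = 1)
    (hsub : ∀ φ : Euc n → ℝ, IsTestFun Ω φ → (∀ x, 0 ≤ φ x) →
          -(lam * ∫ x, |u x| * φ x) ≤ ∫ x, |u x| * lap φ x) :
    ∀ᵐ x ∂volume, |u x| ≤ Real.exp lam * (8 * Real.pi) ^ (-(n : ℝ) / 4) := by
  obtain ⟨R, hR0, hR⟩ := hΩb.subset_ball_lt 0 0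
  have S : Subsol (fun x => |u x|) lam R :=
    { nonneg := fun x => abs_nonneg _
      memLp := h.1.abs
      one := by simpa using h1
      off := by
        filter_upwards [h.zero_off] with x hx hxR
        rw [hx fun hh => ?_, abs_zero]
        have := hR hh
        rw [mem_ball_zero_iff] at this
        linarith
      R0 := hR0
      lam0 := hl
      sub := fun ψ hψ hψ0 => sub_whole h hsub hψ hψ0 }
  exact S.ae_bd

end final

/-- **Eigenfunction sup bound via the heat kernel.** If `u ∈ H¹₀(Ω)` with `∫u² = 1`
satisfies `Δ|u| ≥ −lam·|u|` weakly on `Ω`, then `|u| ≤ e^{lam}·(8π)^{−n/4}` a.e.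
In particular, every normalized first eigenfunction of `Ω` is bounded by
`e^{λ₁(Ω)}·(8π)^{−n/4}` a.e. -/
theorem eigenfun_sup_bound (n : ℕ) (hn : 1 ≤ n) (Ω : Set (Euc n))
    (hΩo : IsOpen Ω) (hΩne : Ω.Nonempty) (hΩb : IsBounded Ω) :
    (∀ (lam : ℝ), 0 ≤ lam →
      ∀ (u : Euc n → ℝ) (Du : Euc n → Euc n), MemH10 Ω u Du →
        (∫ x, u x ^ 2) = 1 →
        (∀ φ : Euc n → ℝ, IsTestFun Ω φ → (∀ x, 0 ≤ φ x) →
          -(lam * ∫ x, |u x| * φ x) ≤ ∫ x, |u x| * lap φ x) →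
        ∀ᵐ x ∂volume, |u x| ≤ Real.exp lam * (8 * Real.pi) ^ (-(n : ℝ) / 4)) ∧
    (∀ u : Euc n → ℝ, IsEigenfun Ω u →
      ∀ᵐ x ∂volume, |u x| ≤ Real.exp (lam1 Ω) * (8 * Real.pi) ^ (-(n : ℝ) / 4)) := by
  refine ⟨fun lam hl u Du h h1 hsub => main_part hΩb hl h h1 hsub, ?_⟩
  rintro u ⟨h0, -, h1, Du, hm, h2⟩
  exact main_part hΩb (lam1_nonneg Ω) hm h1 fun φ hφ _ => eig_sub hm h0 h1 h2 φ hφ
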